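/- Let Ω ⊆ ℝ² be an open connected set and let u, v : Ω → ℝ be two minimal graphs on Ω. Suppose ψ_u and ψ_v are conjugate functions of u and v respectively, both bounded on Ω, admitting continuous extensions to the closure of Ω which coincide at every point of the frontier of Ω. Then u − v is constant on Ω. -/

import Mathlib

open Set Filter Topology Metric
open scoped RealInnerProductSpace

noncomputable section

/-- The plane `ℝ²` with the Euclidean metric. -/
abbrev Pt : Type := EuclideanSpace ℝ (Fin 2)

/-- The point of `ℝ²` with coordinates `(a, b)`. -/
def vec2 (a b : ℝ) : Pt := (WithLp.equiv 2 (Fin 2 → ℝ)).symm ![a, b]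

/-- `W_u = √(1 + ‖∇u‖²)`. -/
def Wu (u : Pt → ℝ) (p : Pt) : ℝ := Real.sqrt (1 + ‖gradient u p‖ ^ 2)

/-- The conjugate vector field `F_u = (−∂₂u/W_u, ∂₁u/W_u)` of a minimal graph `u`. -/
def conjField (u : Pt → ℝ) (p : Pt) : Pt :=
  (Wu u p)⁻¹ • vec2 (-(gradient u p 1)) (gradient u p 0)

/-- `u` is a minimal graph on the open set `Ω`: it is `C²` on `Ω` and satisfies the minimal
surface equation `div (∇u / √(1 + ‖∇u‖²)) = 0` there, the divergence being the sum of the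
partial derivatives of the components of the normalized gradient field. -/
def MinimalGraph (Ω : Set Pt) (u : Pt → ℝ) : Prop :=
  IsOpen Ω ∧ ContDiffOn ℝ 2 u Ω ∧
    ∀ p ∈ Ω, (∑ i : Fin 2,
      fderiv ℝ (fun q => (Wu u q)⁻¹ • gradient u q) p (EuclideanSpace.single i 1) i) = 0

/-- `ψ` is a conjugate function of `u` on `Ω`: it is differentiable with `∇ψ = F_u` on `Ω`. -/
def IsConjugate (Ω : Set Pt) (u ψ : Pt → ℝ) : Prop :=
  ∀ p ∈ Ω, DifferentiableAt ℝ ψ p ∧ gradient ψ p = conjField u p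


/-- Second order expansion data at `0` of a function of one variable. -/
def D2 (g : ℝ → ℝ) (a b : ℝ) : Prop :=
  ∃ g' : ℝ → ℝ, (∀ᶠ t in 𝓝 (0:ℝ), HasDerivAt g (g' t) t) ∧ g' 0 = a ∧ HasDerivAt g' b 0

lemma D2.sub {g k : ℝ → ℝ} {a b c d : ℝ} (hg : D2 g a b) (hk : D2 k c d) :
    D2 (fun t => g t - k t) (a - c) (b - d) := by
  obtain ⟨g', h1, h2, h3⟩ := hg
  obtain ⟨k', l1, l2, l3⟩ := hk
  refine ⟨fun t => g' t - k' t, ?_, by simp [h2, l2], h3.sub l3⟩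
  filter_upwards [h1, l1] with t ht lt using ht.sub lt

lemma D2.add {g k : ℝ → ℝ} {a b c d : ℝ} (hg : D2 g a b) (hk : D2 k c d) :
    D2 (fun t => g t + k t) (a + c) (b + d) := by
  obtain ⟨g', h1, h2, h3⟩ := hg
  obtain ⟨k', l1, l2, l3⟩ := hk
  refine ⟨fun t => g' t + k' t, ?_, by simp [h2, l2], h3.add l3⟩
  filter_upwards [h1, l1] with t ht lt using ht.add lt

lemma D2.const_mul {g : ℝ → ℝ} {a b : ℝ} (c : ℝ) (hg : D2 g a b) :
    D2 (fun t => c * g t) (c * a) (c * b) := by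
  obtain ⟨g', h1, h2, h3⟩ := hg
  refine ⟨fun t => c * g' t, ?_, by simp [h2], h3.const_mul c⟩
  filter_upwards [h1] with t ht using ht.const_mul c

lemma D2.continuousAt {g : ℝ → ℝ} {a b : ℝ} (hg : D2 g a b) : ContinuousAt g 0 := by
  obtain ⟨g', h1, h2, h3⟩ := hg
  exact h1.self_of_nhds.continuousAt

lemma D2.sq {g : ℝ → ℝ} {a b : ℝ} (hg : D2 g a b) :
    D2 (fun t => g t ^ 2) (2 * g 0 * a) (2 * a ^ 2 + 2 * g 0 * b) := by
  obtain ⟨g', h1, h2, h3⟩ := hg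
  refine ⟨fun t => 2 * g t * g' t, ?_, by simp [h2], ?_⟩
  · filter_upwards [h1] with t ht
    simpa [Pi.pow_def] using ht.pow 2
  · have := (h1.self_of_nhds.const_mul 2).mul h3
    rw [h2] at this
    refine this.congr_deriv ?_
    ring

lemma D2.comp {g h h1 : ℝ → ℝ} {a b c : ℝ} (hg : D2 g a b)
    (hh : ∀ᶠ s in 𝓝 (g 0), HasDerivAt h (h1 s) s) (hh1 : HasDerivAt h1 c (g 0)) :
    D2 (fun t => h (g t)) (h1 (g 0) * a) (c * a ^ 2 + h1 (g 0) * b) := by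
  have hc := hg.continuousAt
  obtain ⟨g', l1, l2, l3⟩ := hg
  refine ⟨fun t => h1 (g t) * g' t, ?_, by simp [l2], ?_⟩
  · filter_upwards [l1, hc.eventually hh] with t ht ht2
    exact ht2.comp t ht
  · have := (hh1.comp (0:ℝ) l1.self_of_nhds).mul l3
    rw [l2] at this
    refine this.congr_deriv ?_
    simp only [Function.comp]; ring

lemma D2.nonpos {g : ℝ → ℝ} {a b : ℝ} (hg : D2 g a b) (hm : IsLocalMax g 0) : b ≤ 0 := by
  by_contra hb
  push Not at hb
  have hc := hg.continuousAt
  obtain ⟨g', h1, h2, h3⟩ := hg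
  have hd : deriv g =ᶠ[𝓝 0] g' := by
    filter_upwards [h1] with t ht using ht.deriv
  have hdd : deriv (deriv g) 0 = b := by rw [hd.deriv_eq]; exact h3.deriv
  have hmin : IsLocalMin g 0 :=
    isLocalMin_of_deriv_deriv_pos (by rw [hdd]; exact hb) hm.deriv_eq_zero hc
  have hconst : g =ᶠ[𝓝 0] fun _ => g 0 := by
    filter_upwards [hm, hmin] with t h1 h2 using le_antisymm h1 h2
  have : deriv (deriv g) 0 = 0 := by
    rw [hconst.deriv.deriv_eq]; simp
  linarith

lemma inner_pt (x y : Pt) : ⟪x, y⟫ = x 0 * y 0 + x 1 * y 1 := by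
  simp [PiLp.inner_apply, Fin.sum_univ_two, mul_comm]

lemma normsq_pt (x : Pt) : ‖x‖ ^ 2 = x 0 ^ 2 + x 1 ^ 2 := by
  simp [EuclideanSpace.norm_sq_eq, Fin.sum_univ_two]

@[simp] lemma vec2_0 (a b : ℝ) : vec2 a b 0 = a := by simp [vec2]
@[simp] lemma vec2_1 (a b : ℝ) : vec2 a b 1 = b := by simp [vec2]

/-- `ψ` is a spacelike solution of the maximal surface equation on `Ω`, with gradient `p`
and Hessian `H`. -/
structure MaxS (Ω : Set Pt) (ψ : Pt → ℝ) (p : Pt → Pt) (H : Pt → Pt →L[ℝ] Pt) : Prop where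
  grad : ∀ x ∈ Ω, HasFDerivAt ψ (innerSL ℝ (p x)) x
  hess : ∀ x ∈ Ω, HasFDerivAt p (H x) x
  lt : ∀ x ∈ Ω, ‖p x‖ < 1
  eq : ∀ x ∈ Ω, (1 - p x 1 ^ 2) * H x (vec2 1 0) 0
    + p x 0 * p x 1 * (H x (vec2 1 0) 1 + H x (vec2 0 1) 0)
    + (1 - p x 0 ^ 2) * H x (vec2 0 1) 1 = 0

lemma line_hasDerivAt (x e : Pt) (t : ℝ) : HasDerivAt (fun t : ℝ => x + t • e) e t := by
  simpa using ((hasDerivAt_id t).smul_const e).const_add x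

lemma MaxS.d2 {Ω ψ p H} (h : MaxS Ω ψ p H) (hΩ : IsOpen Ω) {x : Pt} (hx : x ∈ Ω) (e : Pt) :
    D2 (fun t => ψ (x + t • e)) ⟪p x, e⟫ ⟪H x e, e⟫ := by
  refine ⟨fun t => ⟪p (x + t • e), e⟫, ?_, by simp, ?_⟩
  · have : ∀ᶠ t in 𝓝 (0:ℝ), x + t • e ∈ Ω := by
      apply (line_hasDerivAt x e 0).continuousAt.eventually
      simpa using hΩ.mem_nhds hx
    filter_upwards [this] with t ht
    exact ((h.grad _ ht).comp_hasDerivAt t (line_hasDerivAt x e t)).congr_deriv (by simp)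
  · have h1 : HasDerivAt (fun t : ℝ => p (x + t • e)) (H x e) 0 := by
      have := h.hess (x + (0:ℝ) • e) (by simpa using hx)
      exact (this.comp_hasDerivAt (0:ℝ) (line_hasDerivAt x e 0)).congr_deriv (by simp)
    simpa using h1.inner ℝ (hasDerivAt_const (0:ℝ) e)

lemma d2_normsq (a b : Pt) : D2 (fun t => ‖a + t • b‖ ^ 2) (2 * ⟪a, b⟫) (2 * ‖b‖ ^ 2) := by
  have hd : ∀ t : ℝ, HasDerivAt (fun t : ℝ => ‖a + t • b‖ ^ 2) (2 * ⟪a + t • b, b⟫) t :=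
    fun t => (line_hasDerivAt a b t).norm_sq
  refine ⟨_, Eventually.of_forall hd, by simp, ?_⟩
  have := ((line_hasDerivAt a b 0).inner ℝ (hasDerivAt_const (0:ℝ) b)).const_mul 2
  simpa using this

lemma quad_expand (A : Pt →L[ℝ] Pt) (e : Pt) : ⟪A e, e⟫ =
    e 0 ^ 2 * A (vec2 1 0) 0 + e 0 * e 1 * (A (vec2 1 0) 1 + A (vec2 0 1) 0)
      + e 1 ^ 2 * A (vec2 0 1) 1 := by
  have he : e = e 0 • vec2 1 0 + e 1 • vec2 0 1 := by
    ext i; fin_cases i <;> simp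
  have : A e = e 0 • A (vec2 1 0) + e 1 • A (vec2 0 1) := by
    conv_lhs => rw [he]
    simp
  rw [inner_pt, this]
  simp
  ring

/-- second vector of the frame -/
def fr (p n : Pt) : Pt := (Real.sqrt (1 - ‖p‖ ^ 2))⁻¹ •
  vec2 (-(n 1 - ⟪p, n⟫ * p 1)) (n 0 - ⟪p, n⟫ * p 0)

lemma MaxS.frame {Ω ψ p H} (h : MaxS Ω ψ p H) {x : Pt} (hx : x ∈ Ω) (n : Pt) :
    ⟪H x n, n⟫ + ⟪H x (fr (p x) n), fr (p x) n⟫ = 0 := by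
  have h1 : 0 < 1 - ‖p x‖ ^ 2 := by
    have := h.lt x hx
    nlinarith [norm_nonneg (p x)]
  have he := h.eq x hx
  have hs := Real.sq_sqrt h1.le
  have hs0 := Real.sqrt_pos.2 h1
  rw [quad_expand, quad_expand]
  simp only [fr, PiLp.smul_apply, vec2_0, vec2_1, smul_eq_mul, inner_pt]
  rw [normsq_pt] at *
  set s := Real.sqrt (1 - (p x 0 ^ 2 + p x 1 ^ 2))
  generalize (H x (vec2 1 0)) 0 = A at *
  generalize (H x (vec2 1 0)) 1 = B at *
  generalize (H x (vec2 0 1)) 0 = B' at *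
  generalize (H x (vec2 0 1)) 1 = C at *
  generalize p x 0 = p0 at *
  generalize p x 1 = p1 at *
  generalize n 0 = a at *
  generalize n 1 = b at *
  have key : s ^ 2 * (a ^ 2 * A + a * b * (B + B') + b ^ 2 * C) +
    ((-(b - (p0 * a + p1 * b) * p1)) ^ 2 * A + (-(b - (p0 * a + p1 * b) * p1)) * (a - (p0 * a + p1 * b) * p0) * (B + B')
     + (a - (p0 * a + p1 * b) * p0) ^ 2 * C) = 0 := by
    rw [hs]
    linear_combination (a ^ 2 + b ^ 2 - (p0 * a + p1 * b) ^ 2) * he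
  field_simp
  linear_combination key

/-- normalisation -/
lemma fr_norm {p n : Pt} (h : ‖p‖ < 1) :
    ‖fr p n‖ ^ 2 - ⟪p, fr p n⟫ ^ 2 = ‖n‖ ^ 2 - ⟪p, n⟫ ^ 2 := by
  have h1 : 0 < 1 - ‖p‖ ^ 2 := by nlinarith [norm_nonneg p]
  have hs := Real.sq_sqrt h1.le
  have hs0 := Real.sqrt_pos.2 h1
  rw [normsq_pt, normsq_pt]
  simp only [fr, PiLp.smul_apply, vec2_0, vec2_1, smul_eq_mul, inner_pt]
  rw [normsq_pt] at *
  set s := Real.sqrt (1 - (p 0 ^ 2 + p 1 ^ 2))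
  generalize p 0 = p0 at *
  generalize p 1 = p1 at *
  generalize n 0 = a at *
  generalize n 1 = b at *
  field_simp
  rw [hs]
  ring

lemma fr_cross {p q n : Pt} (hp : ‖p‖ < 1) (hq : ‖q‖ < 1) (hn : ⟪p, n⟫ = ⟪q, n⟫) :
    ‖n‖ ^ 2 - ⟪p, n⟫ ^ 2 ≤ ⟪fr p n, fr q n⟫ - ⟪p, fr p n⟫ * ⟪q, fr q n⟫ := by
  have h1 : 0 < 1 - ‖p‖ ^ 2 := by nlinarith [norm_nonneg p]
  have hs := Real.sq_sqrt h1.le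
  have hs0 := Real.sqrt_pos.2 h1
  have h1' : 0 < 1 - ‖q‖ ^ 2 := by nlinarith [norm_nonneg q]
  have hs' := Real.sq_sqrt h1'.le
  have hs0' := Real.sqrt_pos.2 h1'
  have hN : 0 ≤ ‖n‖ ^ 2 - ⟪p, n⟫ ^ 2 := by
    have := abs_real_inner_le_norm p n
    have h2 : |⟪p, n⟫| ≤ ‖n‖ := by nlinarith [norm_nonneg n]
    nlinarith [abs_nonneg ⟪p, n⟫, sq_abs ⟪p, n⟫]
  have hpq : ⟪p, q⟫ ≤ ‖p‖ * ‖q‖ := real_inner_le_norm p q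
  have hC : Real.sqrt (1 - ‖p‖ ^ 2) * Real.sqrt (1 - ‖q‖ ^ 2) ≤ 1 - ⟪p, q⟫ := by
    have : Real.sqrt (1 - ‖p‖ ^ 2) * Real.sqrt (1 - ‖q‖ ^ 2) ≤ 1 - ‖p‖ * ‖q‖ := by
      apply abs_le_of_sq_le_sq' _ _ |>.2
      · rw [mul_pow, hs, hs']; nlinarith [sq_nonneg (‖p‖ - ‖q‖)]
      · nlinarith [norm_nonneg p, norm_nonneg q]
    linarith
  have key : Real.sqrt (1 - ‖p‖ ^ 2) * Real.sqrt (1 - ‖q‖ ^ 2) *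
      (⟪fr p n, fr q n⟫ - ⟪p, fr p n⟫ * ⟪q, fr q n⟫) =
      (‖n‖ ^ 2 - ⟪p, n⟫ ^ 2) * (1 - ⟪p, q⟫) := by
    simp only [fr, PiLp.smul_apply, vec2_0, vec2_1, smul_eq_mul, inner_pt] at *
    rw [normsq_pt n]
    set s := Real.sqrt (1 - ‖p‖ ^ 2)
    set s' := Real.sqrt (1 - ‖q‖ ^ 2)
    generalize p 0 = p0 at *
    generalize p 1 = p1 at *
    generalize q 0 = q0 at *
    generalize q 1 = q1 at *
    generalize n 0 = a at *
    generalize n 1 = b at *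
    rw [← hn]
    field_simp
    ring
  have hpos : 0 < Real.sqrt (1 - ‖p‖ ^ 2) * Real.sqrt (1 - ‖q‖ ^ 2) := by positivity
  by_contra hlt
  push Not at hlt
  have := mul_lt_mul_of_pos_left hlt hpos
  rw [key] at this
  nlinarith [mul_le_mul_of_nonneg_left hC hN]

lemma exists_perp (p q : Pt) : ∃ n : Pt, n ≠ 0 ∧ ⟪p, n⟫ = ⟪q, n⟫ := by
  by_cases h : p = q
  · refine ⟨vec2 1 0, ?_, by rw [h]⟩
    intro h0
    have := congrArg (fun z : Pt => z 0) h0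
    simp at this
  · refine ⟨vec2 (-(p 1 - q 1)) (p 0 - q 0), ?_, ?_⟩
    · intro h0
      have h1 := congrArg (fun z : Pt => z 0) h0
      have h2 := congrArg (fun z : Pt => z 1) h0
      simp at h1 h2
      apply h
      ext i; fin_cases i <;> simp <;> linarith
    · simp only [inner_pt, vec2_0, vec2_1]; ring

/-- gradient bound for `|X|^2` -/
lemma fr_grad {p n X : Pt} (c : ℝ) (h : ‖p‖ < 1) :
    (‖n‖ ^ 2 - ⟪p, n⟫ ^ 2) * (‖X‖ ^ 2 - c ^ 2) ≤
      (⟪X, n⟫ - c * ⟪p, n⟫) ^ 2 + (⟪X, fr p n⟫ - c * ⟪p, fr p n⟫) ^ 2 := by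
  have h1 : 0 < 1 - ‖p‖ ^ 2 := by nlinarith [norm_nonneg p]
  have hs := Real.sq_sqrt h1.le
  have hs0 := Real.sqrt_pos.2 h1
  have hN : 0 ≤ ‖n‖ ^ 2 - ⟪p, n⟫ ^ 2 := by
    have := abs_real_inner_le_norm p n
    have h2 : |⟪p, n⟫| ≤ ‖n‖ := by nlinarith [norm_nonneg n]
    nlinarith [abs_nonneg ⟪p, n⟫, sq_abs ⟪p, n⟫]
  have key : Real.sqrt (1 - ‖p‖ ^ 2) ^ 2 * ((⟪X, n⟫ - c * ⟪p, n⟫) ^ 2 + (⟪X, fr p n⟫ - c * ⟪p, fr p n⟫) ^ 2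
      - (‖n‖ ^ 2 - ⟪p, n⟫ ^ 2) * (‖X‖ ^ 2 - c ^ 2)) =
      (‖n‖ ^ 2 - ⟪p, n⟫ ^ 2) * (⟪X, p⟫ - c) ^ 2 := by
    rw [normsq_pt n, normsq_pt X]
    simp only [fr, PiLp.smul_apply, vec2_0, vec2_1, smul_eq_mul, inner_pt]
    rw [normsq_pt] at *
    set s := Real.sqrt (1 - (p 0 ^ 2 + p 1 ^ 2))
    generalize p 0 = p0 at *
    generalize p 1 = p1 at *
    generalize n 0 = a at *
    generalize n 1 = b at *
    generalize X 0 = x at *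
    generalize X 1 = y at *
    field_simp
    rw [hs]
    ring
  have hpos : 0 < Real.sqrt (1 - ‖p‖ ^ 2) ^ 2 := by positivity
  have h3 : 0 ≤ (‖n‖ ^ 2 - ⟪p, n⟫ ^ 2) * (⟪X, p⟫ - c) ^ 2 := by positivity
  rw [← key] at h3
  have := nonneg_of_mul_nonneg_right h3 hpos
  linarith

/-- the barrier profile -/
def hb (r : ℝ) : ℝ := r⁻¹ - Real.log r

lemma hb_hasDerivAt {r : ℝ} (hr : 0 < r) : HasDerivAt hb (-(r ^ 2)⁻¹ - r⁻¹) r :=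
  (hasDerivAt_inv hr.ne').sub (Real.hasDerivAt_log hr.ne')

lemma hb_hasDerivAt2 {r : ℝ} (hr : 0 < r) :
    HasDerivAt (fun r : ℝ => -(r ^ 2)⁻¹ - r⁻¹) (2 * (r ^ 3)⁻¹ + (r ^ 2)⁻¹) r := by
  have h1 : HasDerivAt (fun r : ℝ => r ^ 2) (2 * r) r := by
    simpa using hasDerivAt_pow 2 r
  refine ((h1.fun_inv (by positivity)).fun_neg.sub (hasDerivAt_inv hr.ne')).congr_deriv ?_
  field_simp
  ring

lemma hb_strictAnti {r s : ℝ} (hr : 0 < r) (hrs : r < s) : hb s < hb r := by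
  unfold hb
  have h1 := Real.log_lt_log hr hrs
  have h2 : s⁻¹ < r⁻¹ := by gcongr
  linarith

lemma hb_continuousOn : ContinuousOn hb (Ioi 0) := fun _ hr =>
  (hb_hasDerivAt hr).continuousAt.continuousWithinAt

def rho (ψ : Pt → ℝ) (x₁ : Pt) (c : ℝ) (x : Pt) : ℝ := ‖x - x₁‖ ^ 2 - (ψ x - c) ^ 2

def FF (ψu ψv : Pt → ℝ) (z : Pt × Pt) : ℝ := (ψu z.1 - ψv z.2) ^ 2 - ‖z.1 - z.2‖ ^ 2

lemma MaxS.const_d2 (c : ℝ) : D2 (fun _ => c) 0 0 :=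
  ⟨fun _ => 0, Eventually.of_forall fun t => hasDerivAt_const t c, rfl, hasDerivAt_const 0 0⟩

/-- second derivative of the barrier along a line -/
lemma rho_d2 {Ω ψ p H} (h : MaxS Ω ψ p H) (hΩ : IsOpen Ω) {x : Pt} (hx : x ∈ Ω) (x₁ : Pt) (c : ℝ)
    (e : Pt) : D2 (fun t => rho ψ x₁ c (x + t • e))
      (2 * (⟪x - x₁, e⟫ - (ψ x - c) * ⟪p x, e⟫))
      (2 * (‖e‖ ^ 2 - ⟪p x, e⟫ ^ 2) - 2 * (ψ x - c) * ⟪H x e, e⟫) := by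
  have h1 := d2_normsq (x - x₁) e
  have h2 := ((h.d2 hΩ hx e).sub (MaxS.const_d2 c)).sq
  have h3 := h1.sub h2
  simp only [zero_smul, add_zero, sub_zero] at h3
  unfold rho
  convert h3 using 1
  · funext t; congr 3; abel_nf
  · ring
  · ring

lemma FF_d2 {Ω ψu ψv pu pv Hu Hv} (hu : MaxS Ω ψu pu Hu) (hv : MaxS Ω ψv pv Hv) (hΩ : IsOpen Ω)
    {x y : Pt} (hx : x ∈ Ω) (hy : y ∈ Ω) (e f : Pt) :
    ∃ a, D2 (fun t => FF ψu ψv (x + t • e, y + t • f)) a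
      (2 * (⟪pu x, e⟫ - ⟪pv y, f⟫) ^ 2
        + 2 * (ψu x - ψv y) * (⟪Hu x e, e⟫ - ⟪Hv y f, f⟫) - 2 * ‖e - f‖ ^ 2) := by
  have h1 := d2_normsq (x - y) (e - f)
  have h2 := ((hu.d2 hΩ hx e).sub (hv.d2 hΩ hy f)).sq
  have h3 := h2.sub h1
  simp only [zero_smul, add_zero] at h3
  refine ⟨2 * (ψu x - ψv y) * (⟪pu x, e⟫ - ⟪pv y, f⟫) - 2 * ⟪x - y, e - f⟫, ?_⟩
  unfold FF
  convert h3 using 1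
  funext t; congr 3; simp only [smul_sub]; abel

lemma inner_sq_lt {p n : Pt} (hp : ‖p‖ < 1) (hn0 : n ≠ 0) : 0 < ‖n‖ ^ 2 - ⟪p, n⟫ ^ 2 := by
  have h1 := abs_real_inner_le_norm p n
  have h0 : 0 < ‖n‖ := norm_pos_iff.2 hn0
  have h2 : |⟪p, n⟫| < ‖n‖ := by nlinarith
  nlinarith [abs_nonneg ⟪p, n⟫, sq_abs ⟪p, n⟫]

lemma alg_contra {ε r N A B c β h k a1 a2 E F ef : ℝ} (hε : 0 < ε) (hr : 0 < r) (hN : 0 < N)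
    (nu : E - a1 ^ 2 = N) (nv : F - a2 ^ 2 = N) (cr : N ≤ ef - a1 * a2)
    (gr : N * r ≤ A ^ 2 + B ^ 2)
    (l1 : 2 * 0 ^ 2 + 2 * β * (h - k) - 2 * 0 ^ 2 + ε * ((2 * (r ^ 3)⁻¹ + (r ^ 2)⁻¹) * (2 * A) ^ 2
      + (-(r ^ 2)⁻¹ - r⁻¹) * (2 * N - 2 * c * h)) ≤ 0)
    (l2 : 2 * (a1 - a2) ^ 2 + 2 * β * (-h - -k) - 2 * (E - 2 * ef + F)
      + ε * ((2 * (r ^ 3)⁻¹ + (r ^ 2)⁻¹) * (2 * B) ^ 2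
      + (-(r ^ 2)⁻¹ - r⁻¹) * (2 * N - 2 * c * -h)) ≤ 0) : False := by
  set P := 2 * (r ^ 3)⁻¹ + (r ^ 2)⁻¹ with hP
  have hPpos : 0 < P := by positivity
  have hident : P * r - (r ^ 2)⁻¹ - r⁻¹ = (r ^ 2)⁻¹ := by
    rw [hP]; field_simp; ring
  have s1 : 0 ≤ 2 * (a1 - a2) ^ 2 - 2 * (E - 2 * ef + F) := by
    nlinarith
  have s2 : 0 < P * (2 * A) ^ 2 + P * (2 * B) ^ 2 + (-(r ^ 2)⁻¹ - r⁻¹) * (4 * N) := by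
    have t1 : P * (N * r) ≤ P * (A ^ 2 + B ^ 2) := mul_le_mul_of_nonneg_left gr hPpos.le
    have t2 : 0 < (r ^ 2)⁻¹ * N := by positivity
    have t3 : P * (N * r) + (-(r ^ 2)⁻¹ - r⁻¹) * N = (r ^ 2)⁻¹ * N := by
      linear_combination N * hident
    linarith
  have s3 := mul_pos hε s2
  linarith

lemma no_max {Ω ψu ψv pu pv Hu Hv} (hu : MaxS Ω ψu pu Hu) (hv : MaxS Ω ψv pv Hv) (hΩ : IsOpen Ω)
    {x y : Pt} (hx : x ∈ Ω) (hy : y ∈ Ω) (x₁ : Pt) (c : ℝ) {ε : ℝ} (hε : 0 < ε)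
    (hr : 0 < rho ψu x₁ c x) :
    ¬ IsLocalMax (fun z : Pt × Pt => FF ψu ψv z + ε * hb (rho ψu x₁ c z.1)) (x, y) := by
  intro hmax
  have line : ∀ e f : Pt, 2 * (⟪pu x, e⟫ - ⟪pv y, f⟫) ^ 2
        + 2 * (ψu x - ψv y) * (⟪Hu x e, e⟫ - ⟪Hv y f, f⟫) - 2 * ‖e - f‖ ^ 2
        + ε * ((2 * (rho ψu x₁ c x ^ 3)⁻¹ + (rho ψu x₁ c x ^ 2)⁻¹) *
            (2 * (⟪x - x₁, e⟫ - (ψu x - c) * ⟪pu x, e⟫)) ^ 2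
          + (-(rho ψu x₁ c x ^ 2)⁻¹ - (rho ψu x₁ c x)⁻¹) *
            (2 * (‖e‖ ^ 2 - ⟪pu x, e⟫ ^ 2) - 2 * (ψu x - c) * ⟪Hu x e, e⟫)) ≤ 0 := by
    intro e f
    obtain ⟨a, h1⟩ := FF_d2 hu hv hΩ hx hy e f
    have h2 := rho_d2 hu hΩ hx x₁ c e
    have e0 : rho ψu x₁ c (x + (0:ℝ) • e) = rho ψu x₁ c x := by simp
    have h3 := h2.comp (h := hb) (h1 := fun r : ℝ => -(r ^ 2)⁻¹ - r⁻¹)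
      (c := 2 * (rho ψu x₁ c x ^ 3)⁻¹ + (rho ψu x₁ c x ^ 2)⁻¹)
      (by
        rw [e0]
        filter_upwards [lt_mem_nhds hr] with s hs using hb_hasDerivAt hs)
      (by rw [e0]; exact hb_hasDerivAt2 hr)
    simp only [e0] at h3
    have h4 := h1.add (h3.const_mul ε)
    refine h4.nonpos ?_
    have hc : ContinuousAt (fun t : ℝ => (x + t • e, y + t • f)) 0 := by fun_prop
    have : Tendsto (fun t : ℝ => (x + t • e, y + t • f)) (𝓝 0) (𝓝 (x, y)) := by
      have := hc.tendsto
      simpa using this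
    have := this.eventually hmax
    filter_upwards [this] with t ht
    simpa using ht
  obtain ⟨n, hn0, hn⟩ := exists_perp (pu x) (pv y)
  have hp := hu.lt x hx
  have hq := hv.lt y hy
  have l1 := line n n
  have l2 := line (fr (pu x) n) (fr (pv y) n)
  have fu := hu.frame hx n
  have fv := hv.frame hy n
  have nu := fr_norm (n := n) hp
  have nv := fr_norm (n := n) hq
  have cr := fr_cross hp hq hn
  have gr := fr_grad (n := n) (X := x - x₁) (ψu x - c) hp
  have hN := inner_sq_lt hp hn0
  have hexp : ‖fr (pu x) n - fr (pv y) n‖ ^ 2 =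
      ‖fr (pu x) n‖ ^ 2 - 2 * ⟪fr (pu x) n, fr (pv y) n⟫ + ‖fr (pv y) n‖ ^ 2 :=
    norm_sub_sq_real _ _
  rw [hexp] at l2
  rw [← hn] at l1 nv
  simp only [sub_self, norm_zero] at l1
  change _ * rho ψu x₁ c x ≤ _ at gr
  have fu' := eq_neg_of_add_eq_zero_right fu
  have fv' := eq_neg_of_add_eq_zero_right fv
  rw [fu', fv', nu] at l2
  exact alg_contra hε hr hN nu nv cr gr l1 l2

/-- pairs joined by a segment in `Ω` -/
def Sg (Ω : Set Pt) : Set (Pt × Pt) := {z | ∀ t ∈ Icc (0:ℝ) 1, z.1 + t • (z.2 - z.1) ∈ Ω}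

lemma Sg_fst {Ω z} (h : z ∈ Sg Ω) : z.1 ∈ Ω := by simpa using h 0 (by simp)
lemma Sg_snd {Ω z} (h : z ∈ Sg Ω) : z.2 ∈ Ω := by simpa using h 1 (by simp)

lemma Sg_open {Ω : Set Pt} (hΩ : IsOpen Ω) : IsOpen (Sg Ω) := by
  rw [isOpen_iff_mem_nhds]
  intro z hz
  apply isCompact_Icc.eventually_forall_of_forall_eventually
  intro t ht
  have hc : Continuous (fun w : (Pt × Pt) × ℝ => w.1.1 + w.2 • (w.1.2 - w.1.1)) := by fun_prop
  exact hc.continuousAt.eventually (hΩ.mem_nhds (hz t ht))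

lemma MaxS.lip_strict {Ω ψ p H} (h : MaxS Ω ψ p H) {x y : Pt} (hxy : (x, y) ∈ Sg Ω)
    (hne : x ≠ y) : |ψ x - ψ y| < ‖x - y‖ := by
  have hd : ∀ t ∈ Icc (0:ℝ) 1, HasDerivAt (fun t : ℝ => ψ (x + t • (y - x)))
      ⟪p (x + t • (y - x)), y - x⟫ t := by
    intro t ht
    exact ((h.grad _ (hxy t ht)).comp_hasDerivAt t (line_hasDerivAt x (y - x) t)).congr_deriv
      (by simp)
  obtain ⟨t, ht, he⟩ := exists_hasDerivAt_eq_slope (fun t : ℝ => ψ (x + t • (y - x)))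
    (fun t => ⟪p (x + t • (y - x)), y - x⟫) (zero_lt_one)
    (fun t ht => (hd t ht).continuousAt.continuousWithinAt)
    (fun t ht => hd t (Ioo_subset_Icc_self ht))
  simp at he
  rw [abs_sub_comm, ← he, norm_sub_rev]
  have h1 := h.lt _ (hxy t (Ioo_subset_Icc_self ht))
  have h0 : 0 < ‖y - x‖ := norm_pos_iff.2 (sub_ne_zero.2 hne.symm)
  have := abs_real_inner_le_norm (p (x + t • (y - x))) (y - x)
  simp only at h1
  nlinarith

lemma MaxS.lip {Ω ψ p H} (h : MaxS Ω ψ p H) {x y : Pt} (hxy : (x, y) ∈ Sg Ω) :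
    |ψ x - ψ y| ≤ ‖x - y‖ := by
  by_cases hne : x = y
  · simp [hne]
  · exact (h.lip_strict hxy hne).le

structure Setup (Ω : Set Pt) (ψu ψv : Pt → ℝ) (pu pv : Pt → Pt) (Hu Hv : Pt → Pt →L[ℝ] Pt)
    (M : ℝ) : Prop where
  op : IsOpen Ω
  hu : MaxS Ω ψu pu Hu
  hv : MaxS Ω ψv pv Hv
  bu : ∀ x ∈ Ω, |ψu x| ≤ M
  bv : ∀ x ∈ Ω, |ψv x| ≤ M
  fr : ∀ z ∈ frontier Ω, Tendsto (fun x => ψu x - ψv x) (𝓝[Ω] z) (𝓝 0)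

/-- admissible pairs -/
def Ek (Ω : Set Pt) (ψu ψv : Pt → ℝ) (κ : ℝ) : Set (Pt × Pt) :=
  {z | z ∈ Sg Ω ∧ 0 ≤ ψu z.1 - ψv z.2 ∧ κ ≤ FF ψu ψv z}

lemma Sg_left {Ω : Set Pt} {x y : Pt} (h : (x, y) ∈ Sg Ω) {s : ℝ} (hs : s ∈ Icc (0:ℝ) 1) :
    (x, x + s • (y - x)) ∈ Sg Ω := by
  intro t ht
  have := h (t * s) ⟨mul_nonneg ht.1 hs.1, mul_le_one₀ ht.2 hs.1 hs.2⟩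
  simpa [smul_smul] using this

lemma Sg_right {Ω : Set Pt} {x y : Pt} (h : (x, y) ∈ Sg Ω) {s : ℝ} (hs : s ∈ Icc (0:ℝ) 1) :
    (x + s • (y - x), y) ∈ Sg Ω := by
  intro t ht
  have := h (s + t * (1 - s)) ⟨by nlinarith [ht.1, hs.1, hs.2], by nlinarith [ht.1, ht.2, hs.1, hs.2]⟩
  simp only at this ⊢
  convert this using 1
  module

lemma MaxS.contAt {Ω ψ p H} (h : MaxS Ω ψ p H) {x : Pt} (hx : x ∈ Ω) : ContinuousAt ψ x :=
  (h.grad x hx).continuousAt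

section
variable {Ω : Set Pt} {ψu ψv : Pt → ℝ} {pu pv : Pt → Pt} {Hu Hv : Pt → Pt →L[ℝ] Pt} {M : ℝ}

lemma Setup.beta_contAt (S : Setup Ω ψu ψv pu pv Hu Hv M) {z : Pt × Pt} (hz : z ∈ Sg Ω) :
    ContinuousAt (fun z : Pt × Pt => ψu z.1 - ψv z.2) z :=
  ((S.hu.contAt (Sg_fst hz)).comp continuousAt_fst).sub
    ((S.hv.contAt (Sg_snd hz)).comp continuousAt_snd)

lemma Setup.FF_contAt (S : Setup Ω ψu ψv pu pv Hu Hv M) {z : Pt × Pt} (hz : z ∈ Sg Ω) :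
    ContinuousAt (FF ψu ψv) z := by
  have h1 := (S.beta_contAt hz).pow 2
  have h2 : ContinuousAt (fun z : Pt × Pt => ‖z.1 - z.2‖ ^ 2) z := by fun_prop
  exact h1.sub h2

lemma Setup.M_nonneg (S : Setup Ω ψu ψv pu pv Hu Hv M) {x} (hx : x ∈ Ω) : 0 ≤ M :=
  (abs_nonneg _).trans (S.bu x hx)

lemma Setup.beta_le (S : Setup Ω ψu ψv pu pv Hu Hv M) {z : Pt × Pt} (hz : z ∈ Sg Ω) :
    ψu z.1 - ψv z.2 ≤ 2 * M := by
  have h1 := abs_le.1 (S.bu _ (Sg_fst hz))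
  have h2 := abs_le.1 (S.bv _ (Sg_snd hz))
  linarith [h1.2, h2.1]

lemma Setup.dist_le (S : Setup Ω ψu ψv pu pv Hu Hv M) {κ : ℝ} (hκ : 0 < κ) {z : Pt × Pt}
    (hz : z ∈ Ek Ω ψu ψv κ) : ‖z.1 - z.2‖ ≤ 2 * M := by
  obtain ⟨h1, h2, h3⟩ := hz
  have h4 := S.beta_le h1
  have : ‖z.1 - z.2‖ ≤ ψu z.1 - ψv z.2 := by
    apply abs_le_of_sq_le_sq' _ h2 |>.2
    unfold FF at h3; linarith
  linarith

lemma Setup.FF_le (S : Setup Ω ψu ψv pu pv Hu Hv M) {κ : ℝ} {z : Pt × Pt}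
    (hz : z ∈ Ek Ω ψu ψv κ) : FF ψu ψv z ≤ 4 * M ^ 2 := by
  obtain ⟨h1, h2, h3⟩ := hz
  have h4 := S.beta_le h1
  unfold FF
  nlinarith [sq_nonneg ‖z.1 - z.2‖]

lemma Setup.isClosed (S : Setup Ω ψu ψv pu pv Hu Hv M) {κ : ℝ} (hκ : 0 < κ) :
    IsClosed (Ek Ω ψu ψv κ) := by
  apply IsSeqClosed.isClosed
  intro z w hz hw
  have hS : w ∈ Sg Ω := by
    intro t ht
    by_contra hnot
    set y := w.1 + t • (w.2 - w.1) with hy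
    set yn := fun n => (z n).1 + t • ((z n).2 - (z n).1) with hyn
    have hc : Continuous (fun w : Pt × Pt => w.1 + t • (w.2 - w.1)) := by fun_prop
    have hlim : Tendsto yn atTop (𝓝 y) := (hc.tendsto w).comp hw
    have hmem : ∀ n, yn n ∈ Ω := fun n => (hz n).1 t ht
    have hfr : y ∈ frontier Ω := by
      rw [frontier, S.op.interior_eq]
      exact ⟨mem_closure_of_tendsto hlim (Eventually.of_forall hmem), hnot⟩
    have hlim2 : Tendsto (fun n => ψu (yn n) - ψv (yn n)) atTop (𝓝 0) :=
      (S.fr y hfr).comp (tendsto_nhdsWithin_iff.2 ⟨hlim, Eventually.of_forall hmem⟩)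
    have hM : 0 ≤ M := S.M_nonneg (hmem 0)
    set D := κ / (4 * M + 1) with hD
    have hDpos : 0 < D := by positivity
    have hlow : ∀ n, min D 1 / 2 ≤ ψu (yn n) - ψv (yn n) := by
      intro n
      have h1 := S.hu.lip (Sg_left (hz n).1 ht)
      have h2 := S.hv.lip (Sg_right (hz n).1 ht)
      have h1' := (abs_le.1 h1).2
      have h2' := (abs_le.1 h2).2
      have hdist : ‖(z n).1 - yn n‖ + ‖yn n - (z n).2‖ = ‖(z n).1 - (z n).2‖ := by
        have e1 : (z n).1 - yn n = t • ((z n).1 - (z n).2) := by simp only [hyn]; module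
        have e2 : yn n - (z n).2 = (1 - t) • ((z n).1 - (z n).2) := by simp only [hyn]; module
        rw [e1, e2, norm_smul, norm_smul, Real.norm_of_nonneg ht.1,
          Real.norm_of_nonneg (by linarith [ht.2])]
        ring
      have h3 := (hz n).2.2
      unfold FF at h3
      have h4 := S.dist_le hκ (hz n)
      by_contra hlt
      push Not at hlt
      have hb : ψu (z n).1 - ψv (z n).2 < ‖(z n).1 - (z n).2‖ + min D 1 / 2 := by
        change ψu (z n).1 - ψu (yn n) ≤ ‖(z n).1 - yn n‖ at h1'
        change ψv (yn n) - ψv (z n).2 ≤ ‖yn n - (z n).2‖ at h2'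
        linarith
      set L := ‖(z n).1 - (z n).2‖
      have hL : 0 ≤ L := norm_nonneg _
      have hb0 := (hz n).2.1
      have hm1 : min D 1 ≤ D := min_le_left _ _
      have hm2 : min D 1 ≤ 1 := min_le_right _ _
      have hm0 : 0 < min D 1 := lt_min hDpos one_pos
      set mm := min D 1
      have hsq : (ψu (z n).1 - ψv (z n).2) ^ 2 < (L + mm / 2) ^ 2 := by
        apply pow_lt_pow_left₀ hb hb0; norm_num
      have hDe : D * (4 * M + 1) = κ := by rw [hD]; field_simp
      nlinarith
    have := ge_of_tendsto' hlim2 hlow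
    have : 0 < min D 1 := lt_min hDpos one_pos
    linarith
  refine ⟨hS, ?_, ?_⟩
  · exact ge_of_tendsto' ((S.beta_contAt hS).tendsto.comp hw) (fun n => (hz n).2.1)
  · exact ge_of_tendsto' ((S.FF_contAt hS).tendsto.comp hw) (fun n => (hz n).2.2)

lemma Setup.isCompact (S : Setup Ω ψu ψv pu pv Hu Hv M) {κ : ℝ} (hκ : 0 < κ) {C : Set Pt}
    (hC : IsCompact C) : IsCompact (Ek Ω ψu ψv κ ∩ {z | z.1 ∈ C}) := by
  obtain ⟨R, hR⟩ := hC.isBounded.subset_closedBall (0 : Pt)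
  have hB : IsCompact (closedBall (0 : Pt) R ×ˢ closedBall (0 : Pt) (R + 2 * M)) :=
    (isCompact_closedBall _ _).prod (isCompact_closedBall _ _)
  refine hB.of_isClosed_subset ((S.isClosed hκ).inter (hC.isClosed.preimage continuous_fst)) ?_
  rintro z ⟨h1, h2⟩
  have h3 := hR h2
  have h4 := S.dist_le hκ h1
  refine ⟨h3, ?_⟩
  simp only [mem_closedBall, dist_zero_right] at h3 ⊢
  have : ‖z.2‖ ≤ ‖z.1‖ + ‖z.1 - z.2‖ := by
    have := norm_sub_le z.1 (z.1 - z.2)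
    simpa using this
  linarith

/-- near an admissible pair with `FF > κ`, everything is admissible -/
lemma Setup.nhds (S : Setup Ω ψu ψv pu pv Hu Hv M) {κ : ℝ} (hκ : 0 < κ) {z : Pt × Pt}
    (hz : z ∈ Ek Ω ψu ψv κ) (hlt : κ < FF ψu ψv z) : Ek Ω ψu ψv κ ∈ 𝓝 z := by
  have hb : 0 < ψu z.1 - ψv z.2 := by
    rcases hz.2.1.lt_or_eq with h | h
    · exact h
    · unfold FF at hlt
      rw [← h] at hlt
      nlinarith [sq_nonneg ‖z.1 - z.2‖]
  filter_upwards [(Sg_open S.op).mem_nhds hz.1, (S.beta_contAt hz.1).eventually (lt_mem_nhds hb),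
    (S.FF_contAt hz.1).eventually (lt_mem_nhds hlt)] with w h1 h2 h3
  exact ⟨h1, h2.le, h3.le⟩

lemma Setup.rho_contAt (S : Setup Ω ψu ψv pu pv Hu Hv M) {x x₁ : Pt} {c : ℝ} (hx : x ∈ Ω) :
    ContinuousAt (rho ψu x₁ c) x := by
  have h1 := ((S.hu.contAt hx).sub (continuousAt_const (y := c))).pow 2
  have h2 : ContinuousAt (fun x : Pt => ‖x - x₁‖ ^ 2) x := by fun_prop
  exact h2.sub h1

/-- maximum principle for the barrier-perturbed function on a compact set of base points -/
lemma Setup.barrier (S : Setup Ω ψu ψv pu pv Hu Hv M) {κ : ℝ} (hκ : 0 < κ) {C : Set Pt}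
    (hC : IsCompact C) {x₁ : Pt} {c ε v : ℝ} (hε : 0 < ε)
    (hr : ∀ x ∈ C, x ∈ Ω → 0 < rho ψu x₁ c x)
    {z₀ : Pt × Pt} (hz₀ : z₀ ∈ Ek Ω ψu ψv κ) (hz₀C : z₀.1 ∈ C)
    (hv₀ : v ≤ FF ψu ψv z₀ + ε * hb (rho ψu x₁ c z₀.1))
    (hin : ∀ z ∈ Ek Ω ψu ψv κ, z.1 ∈ C → v ≤ FF ψu ψv z + ε * hb (rho ψu x₁ c z.1) →
      κ < FF ψu ψv z ∧ C ∈ 𝓝 z.1) : False := by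
  have hcont : ContinuousOn (fun z : Pt × Pt => FF ψu ψv z + ε * hb (rho ψu x₁ c z.1))
      (Ek Ω ψu ψv κ ∩ {z | z.1 ∈ C}) := by
    intro z hz
    have hzΩ := Sg_fst hz.1.1
    have h1 := S.FF_contAt hz.1.1
    have h2 : ContinuousAt (fun z : Pt × Pt => rho ψu x₁ c z.1) z :=
      (S.rho_contAt hzΩ).comp continuousAt_fst
    have h3 : ContinuousAt hb (rho ψu x₁ c z.1) :=
      (hb_hasDerivAt (hr _ hz.2 hzΩ)).continuousAt
    have h4 : ContinuousAt (fun z : Pt × Pt => hb (rho ψu x₁ c z.1)) z :=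
      ContinuousAt.comp (g := hb) h3 h2
    exact (h1.add (h4.const_mul ε)).continuousWithinAt
  obtain ⟨z, hz, hmax⟩ := (S.isCompact hκ hC).exists_isMaxOn ⟨z₀, hz₀, hz₀C⟩ hcont
  have hge := hv₀.trans (hmax ⟨hz₀, hz₀C⟩)
  obtain ⟨h1, h2⟩ := hin z hz.1 hz.2 hge
  refine no_max S.hu S.hv S.op (Sg_fst hz.1.1) (Sg_snd hz.1.1) x₁ c hε
    (hr _ hz.2 (Sg_fst hz.1.1)) ?_
  filter_upwards [S.nhds hκ hz.1 h1, continuous_fst.continuousAt.preimage_mem_nhds h2] with w a b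
  exact hmax ⟨a, b⟩

/-- Step 1: the maximum is attained. -/
lemma Setup.attained (S : Setup Ω ψu ψv pu pv Hu Hv M) {κ : ℝ} (hκ : 0 < κ)
    (hne : (Ek Ω ψu ψv κ).Nonempty) :
    ∃ z ∈ Ek Ω ψu ψv κ, ∀ w ∈ Ek Ω ψu ψv κ, FF ψu ψv w ≤ FF ψu ψv z := by
  obtain ⟨z₀, hz₀⟩ := hne
  have hM : 0 ≤ M := S.M_nonneg (Sg_fst hz₀.1)
  set R₀ := max (M + 1) ‖z₀.1‖ with hR₀
  have hR₀M : M + 1 ≤ R₀ := le_max_left _ _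
  have hFc : ContinuousOn (FF ψu ψv) (Ek Ω ψu ψv κ ∩ {z | z.1 ∈ closedBall 0 R₀}) :=
    fun z hz => (S.FF_contAt hz.1.1).continuousWithinAt
  obtain ⟨z', hz', hmax⟩ := (S.isCompact hκ (isCompact_closedBall (0:Pt) R₀)).exists_isMaxOn
    ⟨z₀, hz₀, by simp [hR₀]⟩ hFc
  refine ⟨z', hz'.1, ?_⟩
  by_contra hcon
  push Not at hcon
  obtain ⟨z₁, hz₁, hlt⟩ := hcon
  have hrho : ∀ x ∈ Ω, R₀ ≤ ‖x‖ → ‖x‖ ^ 2 - M ^ 2 ≤ rho ψu 0 0 x ∧ 1 ≤ rho ψu 0 0 x := by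
    intro x hx hxR
    have h1 := S.bu x hx
    have h2 : ψu x ^ 2 ≤ M ^ 2 := sq_le_sq' (abs_le.1 h1).1 (abs_le.1 h1).2
    have h3 : ‖x‖ ^ 2 - M ^ 2 ≤ rho ψu 0 0 x := by simp only [rho, sub_zero]; linarith
    refine ⟨h3, ?_⟩
    nlinarith
  have hb1 : ∀ r : ℝ, 1 ≤ r → hb r ≤ 1 - Real.log r := by
    intro r hr
    unfold hb
    have : r⁻¹ ≤ 1 := inv_le_one_of_one_le₀ hr
    linarith
  have hb1' : ∀ r : ℝ, 1 ≤ r → hb r ≤ 1 := fun r hr =>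
    (hb1 r hr).trans (by linarith [Real.log_nonneg hr])
  have hz₁R : R₀ < ‖z₁.1‖ := by
    by_contra h
    push Not at h
    have : FF ψu ψv z₁ ≤ FF ψu ψv z' := hmax ⟨hz₁, by simpa using h⟩
    linarith
  obtain ⟨ε, hε, hεlt⟩ : ∃ ε > 0, FF ψu ψv z' + ε < FF ψu ψv z₁ + ε * hb (rho ψu 0 0 z₁.1) := by
    set g := FF ψu ψv z₁ - FF ψu ψv z'
    have hg : 0 < g := by simp only [g]; linarith
    set q := 1 - hb (rho ψu 0 0 z₁.1)
    have hq : 0 ≤ q := by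
      have := hb1' _ (hrho _ (Sg_fst hz₁.1) hz₁R.le).2
      simp only [q]; linarith
    refine ⟨g / (q + 1), by positivity, ?_⟩
    have : g / (q + 1) * q < g := by
      rw [div_mul_eq_mul_div, div_lt_iff₀ (by positivity)]
      nlinarith
    simp only [q, g] at this ⊢
    linarith
  set T := Real.exp (4 * M ^ 2 / ε) with hT
  have hTpos : 0 < T := Real.exp_pos _
  set R₁ := ‖z₁.1‖ + M + T + 1 with hR₁
  have hTR : T < R₁ ^ 2 - M ^ 2 := by
    have : 0 ≤ ‖z₁.1‖ := norm_nonneg _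
    nlinarith [mul_nonneg hM hTpos.le, mul_nonneg this hTpos.le, mul_nonneg this hM, sq_nonneg T]
  refine S.barrier (κ := κ) hκ (C := closedBall 0 R₁ \ ball 0 R₀) (x₁ := 0) (c := 0) (ε := ε)
    (v := FF ψu ψv z₁ + ε * hb (rho ψu 0 0 z₁.1)) ((isCompact_closedBall _ _).diff isOpen_ball) hε
    ?_ hz₁ ?_ le_rfl ?_
  · rintro x ⟨_, hx⟩ hxΩ
    simp at hx
    linarith [(hrho x hxΩ hx).2]
  · refine ⟨?_, ?_⟩
    · simp; linarith
    · simp; linarith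
  · rintro z hz ⟨hzC1, hzC2⟩ hv
    simp at hzC1 hzC2
    have hr := hrho _ (Sg_fst hz.1) hzC2
    have hbz := hb1' _ hr.2
    have hbz2 := hb1 _ hr.2
    have hz'κ := hz'.1.2.2
    have hεb : ε * hb (rho ψu 0 0 z.1) ≤ ε := by nlinarith
    have hFz : FF ψu ψv z' < FF ψu ψv z := by linarith
    refine ⟨by linarith, ?_⟩
    have hin : R₀ < ‖z.1‖ := by
      by_contra h
      push Not at h
      have : FF ψu ψv z ≤ FF ψu ψv z' := hmax ⟨hz, by simpa using h⟩
      linarith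
    have hout : ‖z.1‖ < R₁ := by
      by_contra h
      push Not at h
      have e : ‖z.1‖ = R₁ := le_antisymm hzC1 h
      have h1 : T < rho ψu 0 0 z.1 := by rw [e] at hr; linarith [hr.1]
      have h2 : 4 * M ^ 2 / ε < Real.log (rho ψu 0 0 z.1) := by
        rw [Real.lt_log_iff_exp_lt (by linarith)]; exact h1
      rw [div_lt_iff₀ hε] at h2
      have h3 := S.FF_le hz
      nlinarith
    have : ball (0:Pt) R₁ ∩ (closedBall 0 R₀)ᶜ ∈ 𝓝 z.1 := by
      apply (isOpen_ball.inter isClosed_closedBall.isOpen_compl).mem_nhds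
      simp [hin, hout]
    filter_upwards [this] with x hx
    refine ⟨ball_subset_closedBall hx.1, fun h => hx.2 (ball_subset_closedBall h)⟩

lemma Sg_ball {x₀ : Pt} {R : ℝ} (hR : closedBall x₀ R ⊆ Ω) {x y : Pt} (hx : x ∈ closedBall x₀ R)
    (hy : y ∈ closedBall x₀ R) : (x, y) ∈ Sg Ω := by
  intro t ht
  apply hR
  exact (convex_closedBall x₀ R).add_smul_sub_mem hx hy ht

lemma rho_pos {ψ : Pt → ℝ} {p H} (h : MaxS Ω ψ p H) {x₀ : Pt} {R : ℝ} (hR : closedBall x₀ R ⊆ Ω)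
    {x y : Pt} (hx : x ∈ closedBall x₀ R) (hy : y ∈ closedBall x₀ R) (hne : x ≠ y) :
    0 < rho ψ y (ψ y) x := by
  have := h.lip_strict (Sg_ball hR hx hy) hne
  unfold rho
  nlinarith [abs_nonneg (ψ x - ψ y), sq_abs (ψ x - ψ y)]

/-- Step 2: the set of base points of maximal pairs is open. -/
lemma Setup.isOpenZ (S : Setup Ω ψu ψv pu pv Hu Hv M) {κ m : ℝ} (hκ : 0 < κ) (hm : κ ≤ m)
    (hle : ∀ w ∈ Ek Ω ψu ψv κ, FF ψu ψv w ≤ m) :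
    IsOpen (Prod.fst '' Ek Ω ψu ψv m) := by
  rw [isOpen_iff_mem_nhds]
  rintro _ ⟨z₀, hz₀, rfl⟩
  have hmpos : 0 < m := by linarith
  have hle' : ∀ w ∈ Ek Ω ψu ψv (m / 2), FF ψu ψv w ≤ m := by
    intro w hw
    by_cases h : κ ≤ FF ψu ψv w
    · exact hle w ⟨hw.1, hw.2.1, h⟩
    · linarith
  set x₀ := z₀.1 with hx₀
  have hx₀Ω : x₀ ∈ Ω := Sg_fst hz₀.1
  obtain ⟨R, hRpos, hR⟩ := nhds_basis_closedBall.mem_iff.1 (S.op.mem_nhds hx₀Ω)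
  have hx₀R : x₀ ∈ closedBall x₀ R := by simp [hRpos.le]
  have hnear : ∀ᶠ x₁ in 𝓝 x₀, ∀ x ∈ sphere x₀ R,
      rho ψu x₁ (ψu x₁) x₀ < rho ψu x₁ (ψu x₁) x := by
    apply (isCompact_sphere x₀ R).eventually_forall_of_forall_eventually
    intro x hx
    have hxR : x ∈ closedBall x₀ R := sphere_subset_closedBall hx
    have hxne : x ≠ x₀ := by
      rintro rfl
      simp at hx; linarith
    have hp := rho_pos S.hu hR hxR hx₀R hxne
    have c1 : ContinuousAt (fun w : Pt × Pt => ψu w.1) (x₀, x) :=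
      ContinuousAt.comp (g := ψu) (S.hu.contAt hx₀Ω) continuousAt_fst
    have c2 : ContinuousAt (fun w : Pt × Pt => ψu w.2) (x₀, x) :=
      ContinuousAt.comp (g := ψu) (S.hu.contAt (hR hxR)) continuousAt_snd
    have d1 : ContinuousAt (fun w : Pt × Pt => rho ψu w.1 (ψu w.1) x₀) (x₀, x) :=
      ContinuousAt.sub (by fun_prop) ((continuousAt_const.sub c1).pow 2)
    have d2 : ContinuousAt (fun w : Pt × Pt => rho ψu w.1 (ψu w.1) w.2) (x₀, x) :=
      ContinuousAt.sub (by fun_prop) ((c2.sub c1).pow 2)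
    refine d1.eventually_lt d2 ?_
    simpa [rho] using hp
  filter_upwards [hnear, ball_mem_nhds x₀ hRpos] with x₁ hx₁ hx₁R
  by_contra hnot
  have hx₁R' : x₁ ∈ closedBall x₀ R := ball_subset_closedBall hx₁R
  have hx₁Ω : x₁ ∈ Ω := hR hx₁R'
  have hZc : IsClosed (Prod.fst '' (Ek Ω ψu ψv m ∩ {z | z.1 ∈ closedBall x₀ R})) :=
    ((S.isCompact hmpos (isCompact_closedBall x₀ R)).image continuous_fst).isClosed
  have hx₁n : x₁ ∈ (Prod.fst '' (Ek Ω ψu ψv m ∩ {z | z.1 ∈ closedBall x₀ R}))ᶜ := by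
    rintro ⟨z, hz, e⟩
    exact hnot ⟨z, hz.1, e⟩
  obtain ⟨r, hrpos, hr⟩ := nhds_basis_closedBall.mem_iff.1 (hZc.isOpen_compl.mem_nhds hx₁n)
  have hfar : ∀ z ∈ Ek Ω ψu ψv m, z.1 ∈ closedBall x₀ R → r < dist z.1 x₁ := by
    intro z hz hzR
    by_contra h
    push Not at h
    exact hr (mem_closedBall.2 h) ⟨z, ⟨hz, hzR⟩, rfl⟩
  set C : Set Pt := closedBall x₀ R \ ball x₁ r with hCdef
  have hC : IsCompact C := (isCompact_closedBall _ _).diff isOpen_ball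
  have hne : ∀ x ∈ C, x ≠ x₁ := by
    rintro x ⟨_, hx⟩ rfl
    exact hx (mem_ball_self hrpos)
  have hpos : ∀ x ∈ C, 0 < rho ψu x₁ (ψu x₁) x := fun x hx =>
    rho_pos S.hu hR hx.1 hx₁R' (hne x hx)
  have hx₀C : x₀ ∈ C := ⟨hx₀R, by simpa using (hfar z₀ hz₀ hx₀R).le⟩
  set h₀ := hb (rho ψu x₁ (ψu x₁) x₀) with hh₀
  obtain ⟨h₁, hh₁⟩ : ∃ h₁, ∀ x ∈ C, hb (rho ψu x₁ (ψu x₁) x) ≤ h₁ := by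
    have hcont : ContinuousOn (fun x => hb (rho ψu x₁ (ψu x₁) x)) C := by
      intro x hx
      exact (ContinuousAt.comp (g := hb) (hb_hasDerivAt (hpos x hx)).continuousAt
        (S.rho_contAt (hR hx.1))).continuousWithinAt
    obtain ⟨b, hb'⟩ := (hC.image_of_continuousOn hcont).bddAbove
    exact ⟨b, fun x hx => hb' ⟨x, hx, rfl⟩⟩
  have hh01 : h₀ ≤ h₁ := hh₁ x₀ hx₀C
  obtain ⟨m₁, hm₁, hm₁'⟩ : ∃ m₁ < m, ∀ z ∈ Ek Ω ψu ψv (m / 2),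
      z.1 ∈ closedBall x₀ R ∩ sphere x₁ r → FF ψu ψv z ≤ m₁ := by
    by_cases hemp : (Ek Ω ψu ψv (m / 2) ∩ {z | z.1 ∈ closedBall x₀ R ∩ sphere x₁ r}).Nonempty
    · have hFc : ContinuousOn (FF ψu ψv)
          (Ek Ω ψu ψv (m / 2) ∩ {z | z.1 ∈ closedBall x₀ R ∩ sphere x₁ r}) :=
        fun z hz => (S.FF_contAt hz.1.1).continuousWithinAt
      obtain ⟨z', hz', hmax⟩ := (S.isCompact (half_pos hmpos)
        ((isCompact_closedBall x₀ R).inter_right isClosed_sphere)).exists_isMaxOn hemp hFc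
      refine ⟨FF ψu ψv z', ?_, fun z hz hzC => hmax ⟨hz, hzC⟩⟩
      by_contra h
      push Not at h
      have := hfar z' ⟨hz'.1.1, hz'.1.2.1, h⟩ hz'.2.1
      have h2 := hz'.2.2
      simp only [mem_sphere] at h2
      linarith
    · refine ⟨m - 1, by linarith, fun z hz hzC => ?_⟩
      exact absurd ⟨z, hz, hzC⟩ hemp
  obtain ⟨ε, hε, hε1, hε2⟩ : ∃ ε > 0, ε * (h₁ - h₀) < m - m₁ ∧ ε * (h₁ - h₀) < m / 2 := by
    set g := min (m - m₁) (m / 2)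
    have hg : 0 < g := lt_min (by linarith) (by linarith)
    have hq : 0 ≤ h₁ - h₀ := by linarith
    have : g / (h₁ - h₀ + 1) * (h₁ - h₀) < g := by
      rw [div_mul_eq_mul_div, div_lt_iff₀ (by positivity)]
      nlinarith
    exact ⟨g / (h₁ - h₀ + 1), by positivity, this.trans_le (min_le_left _ _),
      this.trans_le (min_le_right _ _)⟩
  have hz₀2 : z₀ ∈ Ek Ω ψu ψv (m / 2) := ⟨hz₀.1, hz₀.2.1, by linarith [hz₀.2.2]⟩
  refine S.barrier (κ := m / 2) (half_pos hmpos) hC (x₁ := x₁) (c := ψu x₁) (ε := ε)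
    (v := m + ε * h₀) hε (fun x hx _ => hpos x hx) hz₀2 hx₀C ?_ ?_
  · have := hz₀.2.2
    simp only [hh₀, ← hx₀]
    linarith
  · intro z hz hzC hv
    have hb1 : ε * hb (rho ψu x₁ (ψu x₁) z.1) ≤ ε * h₁ :=
      mul_le_mul_of_nonneg_left (hh₁ _ hzC) hε.le
    refine ⟨by linarith, ?_⟩
    have hFm := hle' z hz
    have hout : dist z.1 x₀ < R := by
      rcases (mem_closedBall.1 hzC.1).lt_or_eq with h | h
      · exact h
      · exfalso
        have h1 := hb_strictAnti (hpos x₀ hx₀C) (hx₁ z.1 h)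
        have := mul_lt_mul_of_pos_left h1 hε
        linarith
    have hin : r < dist z.1 x₁ := by
      have h0 : r ≤ dist z.1 x₁ := by simpa using hzC.2
      rcases h0.lt_or_eq with h | h
      · exact h
      · exfalso
        have := hm₁' z hz ⟨hzC.1, mem_sphere.2 h.symm⟩
        linarith
    have : ball x₀ R ∩ (closedBall x₁ r)ᶜ ∈ 𝓝 z.1 := by
      apply (isOpen_ball.inter isClosed_closedBall.isOpen_compl).mem_nhds
      simp [hin, hout]
    filter_upwards [this] with x hx
    refine ⟨ball_subset_closedBall hx.1, fun h => hx.2 (ball_subset_closedBall h)⟩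

/-- Conclusion of the two steps. -/
lemma Setup.conclusion (S : Setup Ω ψu ψv pu pv Hu Hv M) {x : Pt} (hx : x ∈ Ω)
    (hlt : ψv x < ψu x) :
    Ω = univ ∧ ∃ m > 0, (∀ x, ∃ y, (x, y) ∈ Ek Ω ψu ψv m) ∧
      ∀ z ∈ Sg Ω, 0 ≤ ψu z.1 - ψv z.2 → FF ψu ψv z ≤ m := by
  set κ := (ψu x - ψv x) ^ 2 with hκdef
  have hκ : 0 < κ := by have : 0 < ψu x - ψv x := by linarith
                        positivity
  have hne : (x, x) ∈ Ek Ω ψu ψv κ := by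
    refine ⟨fun t _ => by simpa using hx, ?_, ?_⟩
    · simp only; linarith
    · simp [FF, hκdef]
  obtain ⟨z, hz, hmax⟩ := S.attained hκ ⟨_, hne⟩
  set m := FF ψu ψv z
  have hm : κ ≤ m := hz.2.2
  have hmpos : 0 < m := by linarith
  have hopen := S.isOpenZ hκ hm hmax
  have hclosed : IsClosed (Prod.fst '' Ek Ω ψu ψv m) := by
    apply IsSeqClosed.isClosed
    intro a b ha hab
    have hK : IsCompact (insert b (range a)) := hab.isCompact_insert_range
    have h1 := ((S.isCompact hmpos hK).image continuous_fst).isClosed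
    have h2 : b ∈ Prod.fst '' (Ek Ω ψu ψv m ∩ {z | z.1 ∈ insert b (range a)}) := by
      refine h1.mem_of_tendsto hab (Eventually.of_forall fun n => ?_)
      obtain ⟨w, hw, e⟩ := ha n
      exact ⟨w, ⟨hw, by simp [e]⟩, e⟩
    obtain ⟨w, hw, e⟩ := h2
    exact ⟨w, hw.1, e⟩
  have huniv : Prod.fst '' Ek Ω ψu ψv m = univ :=
    IsClopen.eq_univ ⟨hclosed, hopen⟩ ⟨z.1, z, ⟨hz.1, hz.2.1, le_rfl⟩, rfl⟩
  have hall : ∀ x, ∃ y, (x, y) ∈ Ek Ω ψu ψv m := by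
    intro x
    have : x ∈ Prod.fst '' Ek Ω ψu ψv m := by rw [huniv]; trivial
    obtain ⟨w, hw, rfl⟩ := this
    exact ⟨w.2, hw⟩
  refine ⟨?_, m, hmpos, hall, ?_⟩
  · ext x
    simp only [mem_univ, iff_true]
    obtain ⟨y, hy⟩ := hall x
    exact Sg_fst hy.1
  · intro w hw hβ
    by_cases h : κ ≤ FF ψu ψv w
    · exact hmax w ⟨hw, hβ, h⟩
    · linarith

end

lemma wdiv_deriv {a b : ℝ → ℝ} {a' b' t : ℝ} (ha : HasDerivAt a a' t) (hb : HasDerivAt b b' t) :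
    HasDerivAt (fun t => (Real.sqrt (1 + (a t ^ 2 + b t ^ 2)))⁻¹ * a t)
      (a' / Real.sqrt (1 + (a t ^ 2 + b t ^ 2))
        - a t * (a t * a' + b t * b') / Real.sqrt (1 + (a t ^ 2 + b t ^ 2)) ^ 3) t := by
  have h0 : 0 < 1 + (a t ^ 2 + b t ^ 2) := by positivity
  have hs := Real.sqrt_pos.2 h0
  have h1 : HasDerivAt (fun t => 1 + (a t ^ 2 + b t ^ 2)) (2 * a t * a' + 2 * b t * b') t := by
    have := ((ha.fun_pow 2).fun_add (hb.fun_pow 2)).const_add 1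
    refine this.congr_deriv ?_
    simp
  have h2 := ((h1.sqrt h0.ne').fun_inv hs.ne').fun_mul ha
  refine h2.congr_deriv ?_
  field_simp
  ring

lemma grad_coord (u : Pt → ℝ) (q : Pt) (e : Pt) : ⟪gradient u q, e⟫ = fderiv ℝ u q e := by
  simp [gradient, InnerProductSpace.toDual_symm_apply]

lemma Wu_eq (u : Pt → ℝ) (q : Pt) :
    Wu u q = Real.sqrt (1 + (gradient u q 0 ^ 2 + gradient u q 1 ^ 2)) := by
  rw [Wu, normsq_pt]

lemma hasDerivAt_coord {g : ℝ → Pt} {g' : Pt} {t : ℝ} (h : HasDerivAt g g' t) (i : Fin 2) :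
    HasDerivAt (fun t => g t i) (g' i) t :=
  ((EuclideanSpace.proj (𝕜 := ℝ) i : Pt →L[ℝ] ℝ).hasFDerivAt.comp_hasDerivAt t h)

set_option maxHeartbeats 2000000 in
lemma maxS_of_minimal {Ω : Set Pt} (hΩ : IsOpen Ω) {u ψ : Pt → ℝ} (hu : MinimalGraph Ω u)
    (hψ : IsConjugate Ω u ψ) : MaxS Ω ψ (conjField u) (fderiv ℝ (conjField u)) := by
  have hC : ∀ x ∈ Ω, ContDiffAt ℝ 2 u x := fun x hx => hu.2.1.contDiffAt (hΩ.mem_nhds hx)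
  have hg0 : ∀ q, gradient u q 0 = fderiv ℝ u q (vec2 1 0) := by
    intro q; rw [← grad_coord, inner_pt]; simp
  have hg1 : ∀ q, gradient u q 1 = fderiv ℝ u q (vec2 0 1) := by
    intro q; rw [← grad_coord, inner_pt]; simp
  have hg : ∀ x ∈ Ω, DifferentiableAt ℝ (fderiv ℝ u) x := fun x hx =>
    ((hC x hx).fderiv_right (m := 1) (by norm_num)).differentiableAt (by norm_num)
  have hdiff : ∀ x ∈ Ω, DifferentiableAt ℝ (conjField u) x := by
    intro x hx
    have hd0 : DifferentiableAt ℝ (fun q => gradient u q 0) x := by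
      simp only [hg0]
      exact (hg x hx).clm_apply (differentiableAt_const _)
    have hd1 : DifferentiableAt ℝ (fun q => gradient u q 1) x := by
      simp only [hg1]
      exact (hg x hx).clm_apply (differentiableAt_const _)
    have h2 : ∀ i, DifferentiableAt ℝ (fun q => gradient u q i) x := by
      intro i
      fin_cases i
      · exact hd0
      · exact hd1
    have h3 : DifferentiableAt ℝ (Wu u) x := by
      have : Wu u = fun q => Real.sqrt (1 + (gradient u q 0 ^ 2 + gradient u q 1 ^ 2)) := by
        funext q; exact Wu_eq u q
      rw [this]
      have h0 := h2 0
      have h1 := h2 1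
      exact DifferentiableAt.sqrt (by fun_prop) (by positivity)
    have hW : Wu u x ≠ 0 := by
      rw [Wu_eq]; exact (Real.sqrt_pos.2 (by positivity)).ne'
    have h4 : DifferentiableAt ℝ (fun q => vec2 (-(gradient u q 1)) (gradient u q 0)) x := by
      rw [differentiableAt_euclidean]
      intro i
      fin_cases i
      · simpa using (h2 1).neg
      · simpa using h2 0
    exact (h3.inv hW).smul h4
  have hcoord0 : ∀ q, conjField u q 0 = -((Real.sqrt (1 + (gradient u q 1 ^ 2 + gradient u q 0 ^ 2)))⁻¹ * gradient u q 1) := by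
    intro q; simp [conjField, Wu_eq, add_comm]
  have hcoord1 : ∀ q, conjField u q 1 = (Real.sqrt (1 + (gradient u q 0 ^ 2 + gradient u q 1 ^ 2)))⁻¹ * gradient u q 0 := by
    intro q; simp [conjField, Wu_eq]
  refine ⟨?_, fun x hx => (hdiff x hx).hasFDerivAt, ?_, ?_⟩
  · intro x hx
    obtain ⟨h1, h2⟩ := hψ x hx
    have := h1.hasGradientAt.hasFDerivAt
    rw [h2] at this
    exact this
  · intro x hx
    have h0 := hcoord0 x
    have h1 := hcoord1 x
    have hW : 0 < 1 + (gradient u x 0 ^ 2 + gradient u x 1 ^ 2) := by positivity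
    rw [add_comm (gradient u x 1 ^ 2)] at h0
    have hs := Real.sq_sqrt hW.le
    have hs0 := Real.sqrt_pos.2 hW
    have : ‖conjField u x‖ ^ 2 < 1 := by
      rw [normsq_pt, h0, h1]
      set s := Real.sqrt (1 + (gradient u x 0 ^ 2 + gradient u x 1 ^ 2))
      have : (-(s⁻¹ * gradient u x 1)) ^ 2 + (s⁻¹ * gradient u x 0) ^ 2
          = (gradient u x 0 ^ 2 + gradient u x 1 ^ 2) / s ^ 2 := by field_simp; ring
      rw [this, hs, div_lt_one hW]; linarith
    nlinarith [norm_nonneg (conjField u x)]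
  · intro x hx
    have hline : ∀ e f : Pt, HasDerivAt (fun t : ℝ => fderiv ℝ u (x + t • e) f)
        (fderiv ℝ (fderiv ℝ u) x e f) 0 := by
      intro e f
      have h1 := (hg (x + (0:ℝ) • e) (by simpa using hx)).hasFDerivAt
      have h2 := (h1.comp_hasDerivAt (0:ℝ) (line_hasDerivAt x e 0)).clm_apply
        (hasDerivAt_const (0:ℝ) f)
      exact h2.congr_deriv (by simp)
    have hlinep : ∀ e : Pt, HasDerivAt (fun t : ℝ => conjField u (x + t • e))
        (fderiv ℝ (conjField u) x e) 0 := by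
      intro e
      have := (hdiff (x + (0:ℝ) • e) (by simpa using hx)).hasFDerivAt
      have h2 := this.comp_hasDerivAt (0:ℝ) (line_hasDerivAt x e 0)
      rw [zero_smul, add_zero] at h2
      exact h2
    have hsymm : fderiv ℝ (fderiv ℝ u) x (vec2 1 0) (vec2 0 1)
        = fderiv ℝ (fderiv ℝ u) x (vec2 0 1) (vec2 1 0) :=
      ((hC x hx).isSymmSndFDerivAt (by simp)).eq _ _
    have key : ∀ e : Pt,
        fderiv ℝ (conjField u) x e 0 = -(fderiv ℝ (fderiv ℝ u) x e (vec2 0 1) /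
          Real.sqrt (1 + (gradient u x 1 ^ 2 + gradient u x 0 ^ 2)) -
          gradient u x 1 * (gradient u x 1 * fderiv ℝ (fderiv ℝ u) x e (vec2 0 1)
            + gradient u x 0 * fderiv ℝ (fderiv ℝ u) x e (vec2 1 0)) /
          Real.sqrt (1 + (gradient u x 1 ^ 2 + gradient u x 0 ^ 2)) ^ 3) ∧
        fderiv ℝ (conjField u) x e 1 = fderiv ℝ (fderiv ℝ u) x e (vec2 1 0) /
          Real.sqrt (1 + (gradient u x 0 ^ 2 + gradient u x 1 ^ 2)) -
          gradient u x 0 * (gradient u x 0 * fderiv ℝ (fderiv ℝ u) x e (vec2 1 0)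
            + gradient u x 1 * fderiv ℝ (fderiv ℝ u) x e (vec2 0 1)) /
          Real.sqrt (1 + (gradient u x 0 ^ 2 + gradient u x 1 ^ 2)) ^ 3 := by
      intro e
      have a0 := hline e (vec2 1 0)
      have a1 := hline e (vec2 0 1)
      simp only [← hg0] at a0
      simp only [← hg1] at a1
      have p0 := hasDerivAt_coord (hlinep e) 0
      have p1 := hasDerivAt_coord (hlinep e) 1
      simp only [hcoord0] at p0
      simp only [hcoord1] at p1
      have q0 := (wdiv_deriv a1 a0).fun_neg
      have q1 := wdiv_deriv a0 a1
      have r0 := p0.unique q0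
      have r1 := p1.unique q1
      simp only [zero_smul, add_zero] at r0 r1
      exact ⟨r0, r1⟩
    rw [(key _).1, (key _).2, (key _).1, (key _).2, hcoord0, hcoord1, hsymm]
    have hW : 0 < 1 + (gradient u x 0 ^ 2 + gradient u x 1 ^ 2) := by positivity
    rw [add_comm (gradient u x 1 ^ 2)]
    have hs := Real.sq_sqrt hW.le
    have hs0 := Real.sqrt_pos.2 hW
    set s := Real.sqrt (1 + (gradient u x 0 ^ 2 + gradient u x 1 ^ 2))
    generalize gradient u x 0 = a at *
    generalize gradient u x 1 = b at *
    generalize fderiv ℝ (fderiv ℝ u) x (vec2 1 0) (vec2 1 0) = A at *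
    generalize fderiv ℝ (fderiv ℝ u) x (vec2 0 1) (vec2 1 0) = B at *
    generalize fderiv ℝ (fderiv ℝ u) x (vec2 0 1) (vec2 0 1) = C at *
    field_simp
    rw [hs]
    ring

lemma w_inj {a b c d : ℝ}
    (h1 : (Real.sqrt (1 + (a ^ 2 + b ^ 2)))⁻¹ * a = (Real.sqrt (1 + (c ^ 2 + d ^ 2)))⁻¹ * c)
    (h2 : (Real.sqrt (1 + (a ^ 2 + b ^ 2)))⁻¹ * b = (Real.sqrt (1 + (c ^ 2 + d ^ 2)))⁻¹ * d) :
    a = c ∧ b = d := by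
  have hW : 0 < 1 + (a ^ 2 + b ^ 2) := by positivity
  have hV : 0 < 1 + (c ^ 2 + d ^ 2) := by positivity
  have hs := Real.sq_sqrt hW.le
  have hs0 := Real.sqrt_pos.2 hW
  have ht := Real.sq_sqrt hV.le
  have ht0 := Real.sqrt_pos.2 hV
  set s := Real.sqrt (1 + (a ^ 2 + b ^ 2))
  set t := Real.sqrt (1 + (c ^ 2 + d ^ 2))
  have e1 : s⁻¹ ^ 2 = 1 - (s⁻¹ * a) ^ 2 - (s⁻¹ * b) ^ 2 := by
    field_simp; linarith
  have e2 : t⁻¹ ^ 2 = 1 - (t⁻¹ * c) ^ 2 - (t⁻¹ * d) ^ 2 := by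
    field_simp; linarith
  rw [h1, h2, ← e2] at e1
  have e3 : s⁻¹ = t⁻¹ := (pow_left_inj₀ (by positivity) (by positivity) two_ne_zero).1 e1
  rw [e3] at h1 h2
  have : t⁻¹ ≠ 0 := by positivity
  exact ⟨mul_left_cancel₀ this h1, mul_left_cancel₀ this h2⟩

lemma gradient_eq_of_conj {u v : Pt → ℝ} {x : Pt} (h : conjField u x = conjField v x) :
    gradient u x = gradient v x := by
  have h0 := congrArg (fun z : Pt => z 0) h
  have h1 := congrArg (fun z : Pt => z 1) h
  simp only [conjField, Wu_eq, PiLp.smul_apply, vec2_0, vec2_1, smul_eq_mul, mul_neg,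
    neg_inj] at h0 h1
  obtain ⟨e0, e1⟩ := w_inj h1 h0
  ext i; fin_cases i
  · exact e0
  · exact e1

lemma const_of_entire {ψ : Pt → ℝ} {p H} (h : MaxS univ ψ p H) {M : ℝ}
    (hb : ∀ x, |ψ x| ≤ M) : ∃ c, ∀ x, ψ x = c := by
  have hM : 0 ≤ M := (abs_nonneg _).trans (hb 0)
  have S : Setup univ ψ (fun _ => -(M + 1)) p (fun _ => 0) H (fun _ => 0) (M + 1) := by
    refine ⟨isOpen_univ, h, ⟨?_, ?_, ?_, ?_⟩, fun x _ => (hb x).trans (by linarith), ?_, ?_⟩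
    · intro x _
      have h0 : HasFDerivAt (fun _ : Pt => -(M + 1)) (0 : Pt →L[ℝ] ℝ) x :=
        hasFDerivAt_const (-(M + 1)) x
      rw [map_zero]
      exact h0
    · intro x _
      exact hasFDerivAt_const (0 : Pt) x
    · intro x _; simp
    · intro x _; simp
    · intro x _; rw [abs_neg, abs_of_nonneg (by linarith)]
    · simp
  have hpos : ∀ x, 0 < ψ x + (M + 1) := fun x => by linarith [(abs_le.1 (hb x)).1]
  obtain ⟨_, m, hm, h1, h2⟩ := S.conclusion (x := 0) trivial (by linarith [hpos 0])
  refine ⟨Real.sqrt m - (M + 1), fun x => ?_⟩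
  obtain ⟨y, hy⟩ := h1 x
  have h3 := hy.2.2
  have h4 := h2 (x, x) (fun t _ => trivial) (by simp only; linarith [hpos x])
  simp only [FF, sub_neg_eq_add, sub_self, norm_zero] at h3 h4
  have : (ψ x + (M + 1)) ^ 2 = m := by
    apply le_antisymm
    · simpa using h4
    · nlinarith [sq_nonneg ‖x - y‖]
  rw [← this, Real.sqrt_sq (hpos x).le]; ring

/-- Mazet's uniqueness lemma: two minimal graphs on a connected domain whose bounded
conjugate functions extend continuously to the closure and agree on the frontier differ
by a constant. -/
theorem uniqueness_from_conjugate_boundary_values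
    (Ω : Set Pt) (hΩ : IsOpen Ω) (hconn : IsConnected Ω)
    (u v ψu ψv : Pt → ℝ)
    (hu : MinimalGraph Ω u) (hv : MinimalGraph Ω v)
    (hψu : IsConjugate Ω u ψu) (hψv : IsConjugate Ω v ψv)
    (hbu : ∃ M : ℝ, ∀ p ∈ Ω, |ψu p| ≤ M) (hbv : ∃ M : ℝ, ∀ p ∈ Ω, |ψv p| ≤ M)
    (ψub ψvb : Pt → ℝ)
    (hub : ContinuousOn ψub (closure Ω)) (hue : EqOn ψub ψu Ω)
    (hvb : ContinuousOn ψvb (closure Ω)) (hve : EqOn ψvb ψv Ω)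
    (hbdry : ∀ x ∈ frontier Ω, ψub x = ψvb x) :
    ∃ c : ℝ, ∀ p ∈ Ω, u p - v p = c := by
  obtain ⟨M₁, hM₁⟩ := hbu
  obtain ⟨M₂, hM₂⟩ := hbv
  have mu := maxS_of_minimal hΩ hu hψu
  have mv := maxS_of_minimal hΩ hv hψv
  have hfr : ∀ z ∈ frontier Ω, Tendsto (fun x => ψu x - ψv x) (𝓝[Ω] z) (𝓝 0) := by
    intro z hz
    have hzc : z ∈ closure Ω := frontier_subset_closure hz
    have h1 := ((hub z hzc).sub (hvb z hzc)).mono subset_closure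
    have h2 : Tendsto (fun x => ψub x - ψvb x) (𝓝[Ω] z) (𝓝 (ψub z - ψvb z)) := h1
    rw [hbdry z hz, sub_self] at h2
    refine h2.congr' ?_
    filter_upwards [self_mem_nhdsWithin] with x hx
    rw [hue hx, hve hx]
  have hgrad : ∀ x ∈ Ω, gradient ψu x = gradient ψv x := by
    by_cases hΩu : Ω = univ
    · subst hΩu
      obtain ⟨c, hc⟩ := const_of_entire mu (fun x => hM₁ x trivial)
      obtain ⟨d, hd⟩ := const_of_entire mv (fun x => hM₂ x trivial)
      intro x _
      rw [show ψu = fun _ => c from funext hc, show ψv = fun _ => d from funext hd]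
      simp [gradient]
    · have S1 : Setup Ω ψu ψv _ _ _ _ (max M₁ M₂) :=
        ⟨hΩ, mu, mv, fun x hx => (hM₁ x hx).trans (le_max_left _ _),
          fun x hx => (hM₂ x hx).trans (le_max_right _ _), hfr⟩
      have S2 : Setup Ω ψv ψu _ _ _ _ (max M₁ M₂) :=
        ⟨hΩ, mv, mu, S1.bv, S1.bu, fun z hz => by
          have := (hfr z hz).neg
          simpa using this⟩
      have heq : ∀ x ∈ Ω, ψu x = ψv x := by
        intro x hx
        apply le_antisymm
        · by_contra h
          push Not at h
          exact hΩu (S1.conclusion hx h).1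
        · by_contra h
          push Not at h
          exact hΩu (S2.conclusion hx h).1
      intro x hx
      have : ψu =ᶠ[𝓝 x] ψv := by
        filter_upwards [hΩ.mem_nhds hx] with y hy using heq y hy
      rw [gradient, gradient, this.fderiv_eq]
  have hg : ∀ x ∈ Ω, fderiv ℝ u x = fderiv ℝ v x := by
    intro x hx
    have h1 := hgrad x hx
    rw [(hψu x hx).2, (hψv x hx).2] at h1
    have h2 := gradient_eq_of_conj h1
    ext e
    rw [← grad_coord, ← grad_coord, h2]
  have hdu : DifferentiableOn ℝ u Ω := hu.2.1.differentiableOn (by norm_num)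
  have hdv : DifferentiableOn ℝ v Ω := hv.2.1.differentiableOn (by norm_num)
  have hd : DifferentiableOn ℝ (fun x => u x - v x) Ω := hdu.sub hdv
  obtain ⟨x₀, hx₀⟩ := hconn.nonempty
  refine ⟨u x₀ - v x₀, fun x hx => ?_⟩
  refine hΩ.is_const_of_fderiv_eq_zero (𝕜 := ℝ) hconn.isPreconnected hd ?_ hx hx₀
  intro y hy
  have := fderiv_fun_sub (hdu.differentiableAt (hΩ.mem_nhds hy))
    (hdv.differentiableAt (hΩ.mem_nhds hy))
  rw [this, hg y hy]
  simp
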